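/- arXiv:1511.06518 — 4 statements merged into one kernel-verified Lean document; each statement's English description precedes it below -/
import Mathlib

section
/- For every natural number n ≥ 1 and every real x ≥ 0, (1 - exp(-x / Γ(n+1)^{1/n}))^n ≤ P(n, x), with equality for all x when n = 1. -/
open Real MeasureTheory ProbabilityTheory Filter

/-- The regularized lower incomplete gamma function
`P(s,x) = (∫₀ˣ t^(s-1) e^(-t) dt) / Γ(s)`. -/
noncomputable def regP (s x : ℝ) : ℝ :=
  (∫ t in (0:ℝ)..x, t ^ (s - 1) * Real.exp (-t)) / Real.Gamma s

theorem integral_exp_neg_mul_zero_one {s : ℝ} (hs : 0 < s) :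
    ∫ t in Set.Ioc (0 : ℝ) 1, Real.exp (-(s * t)) = (1 - Real.exp (-s)) / s := by
  rw [← intervalIntegral.integral_of_le zero_le_one]
  have h : ∀ t ∈ Set.uIcc (0 : ℝ) 1,
      HasDerivAt (fun t => -Real.exp (-(s * t)) / s) (Real.exp (-(s * t))) t := by
    intro t _
    have h1 : HasDerivAt (fun t : ℝ => -(s * t)) (-(s * 1)) t :=
      ((hasDerivAt_id t).const_mul s).neg
    refine (h1.exp.neg.div_const s).congr_deriv ?_
    field_simp
  rw [intervalIntegral.integral_eq_sub_of_hasDerivAt h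
    (Continuous.intervalIntegrable (by fun_prop) _ _)]
  simp
  ring

/-- The power mean inequality for `t ↦ exp (-t)` on `(0, 1]`. -/
theorem one_sub_exp_neg_div_rpow_le {s p : ℝ} (hs : 0 < s) (hp : 1 ≤ p) :
    ((1 - Real.exp (-s)) / s) ^ p ≤ (1 - Real.exp (-(p * s))) / (p * s) := by
  have : IsProbabilityMeasure (volume.restrict (Set.Ioc (0 : ℝ) 1)) := ⟨by simp⟩
  have hint : ∀ r : ℝ, Integrable (fun t => Real.exp (-(r * t)))
      (volume.restrict (Set.Ioc (0 : ℝ) 1)) := fun r =>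
    (Continuous.integrableOn_Icc (by fun_prop)).mono_set Set.Ioc_subset_Icc_self
  have hpow : ∀ t : ℝ, Real.exp (-(s * t)) ^ p = Real.exp (-(p * s * t)) := by
    intro t
    rw [← Real.exp_mul]
    ring_nf
  have key := (convexOn_rpow hp).map_integral_le
    (μ := volume.restrict (Set.Ioc (0 : ℝ) 1)) (f := fun t => Real.exp (-(s * t)))
    (continuousOn_id.rpow_const fun _ _ => Or.inr (by linarith)) isClosed_Ici
    (Eventually.of_forall fun t => (Real.exp_pos _).le) (hint s)
    (by simpa only [Function.comp_def, hpow] using hint (p * s))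
  simp only [hpow] at key
  rwa [integral_exp_neg_mul_zero_one hs, integral_exp_neg_mul_zero_one (by positivity)] at key

theorem one_sub_exp_neg_div_pow_le_exp_of_le (m : ℕ) {c s t : ℝ} (hs : 0 < s) (hst : s ≤ t)
    (h : ((1 - Real.exp (-t)) / t) ^ m ≤ Real.exp (c * t)) :
    ((1 - Real.exp (-s)) / s) ^ m ≤ Real.exp (c * s) := by
  have ht : 0 < t := hs.trans_le hst
  have hq : 0 ≤ (1 - Real.exp (-s)) / s :=
    div_nonneg (by simpa using hs.le) hs.le
  have hmean := one_sub_exp_neg_div_rpow_le hs ((one_le_div hs).2 hst)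
  rw [div_mul_cancel₀ t hs.ne'] at hmean
  have hle : (((1 - Real.exp (-s)) / s) ^ m) ^ (t / s) ≤ Real.exp (c * s) ^ (t / s) := by
    calc (((1 - Real.exp (-s)) / s) ^ m) ^ (t / s)
        = (((1 - Real.exp (-s)) / s) ^ (t / s)) ^ m := by
          rw [← Real.rpow_natCast, ← Real.rpow_natCast, ← Real.rpow_mul hq, ← Real.rpow_mul hq,
            mul_comm]
      _ ≤ ((1 - Real.exp (-t)) / t) ^ m := by gcongr
      _ ≤ Real.exp (c * t) := h
      _ = Real.exp (c * s) ^ (t / s) := by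
          rw [← Real.exp_mul]
          congr 1
          field_simp
  exact (Real.rpow_le_rpow_iff (by positivity) (Real.exp_pos _).le (by positivity)).1 hle

theorem regP_natCast_succ (m : ℕ) (x : ℝ) :
    regP ((m + 1 : ℕ) : ℝ) x = (∫ t in (0 : ℝ)..x, t ^ m * Real.exp (-t)) / (m.factorial : ℝ) := by
  simp [regP, Real.Gamma_nat_eq_factorial]

theorem hasDerivAt_regP_natCast_succ (m : ℕ) (x : ℝ) :
    HasDerivAt (regP ((m + 1 : ℕ) : ℝ)) (x ^ m * Real.exp (-x) / (m.factorial : ℝ)) x := by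
  rw [funext (regP_natCast_succ m)]
  have hc : Continuous fun t : ℝ => t ^ m * Real.exp (-t) := by fun_prop
  exact (hc.integral_hasStrictDerivAt 0 x).hasDerivAt.div_const _

theorem tendsto_regP_atTop {s : ℝ} (hs : 0 < s) : Tendsto (regP s) atTop (nhds 1) := by
  have h := intervalIntegral_tendsto_integral_Ioi 0 (Real.GammaIntegral_convergent hs) tendsto_id
  rw [← Real.Gamma_eq_integral hs] at h
  have h' := h.div_const (Real.Gamma s)
  rw [div_self (Real.Gamma_pos_of_pos hs).ne'] at h'
  refine h'.congr fun x => ?_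
  simp only [regP, id, mul_comm]

theorem one_sub_exp_pow_le_regP (m : ℕ) {d x : ℝ} (hd : 0 < d)
    (hdm : d ^ (m + 1) * ((m + 1).factorial : ℝ) = 1) (hx : 0 ≤ x) :
    (1 - Real.exp (-(d * x))) ^ (m + 1) ≤ regP ((m + 1 : ℕ) : ℝ) x := by
  set F : ℝ → ℝ := fun y => regP ((m + 1 : ℕ) : ℝ) y - (1 - Real.exp (-(d * y))) ^ (m + 1) with hF
  set F' : ℝ → ℝ := fun y => y ^ m * Real.exp (-y) / (m.factorial : ℝ) -
    (m + 1) * d * (1 - Real.exp (-(d * y))) ^ m * Real.exp (-(d * y)) with hF'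
  have hderiv : ∀ y, HasDerivAt F (F' y) y := by
    intro y
    have h1 : HasDerivAt (fun y : ℝ => -(d * y)) (-(d * 1)) y :=
      ((hasDerivAt_id y).const_mul d).neg
    refine ((hasDerivAt_regP_natCast_succ m y).sub ((h1.exp.const_sub 1).pow (m + 1))).congr_deriv ?_
    simp only [hF', Nat.add_sub_cancel]
    push_cast
    ring
  have hcont : Continuous F := continuous_iff_continuousAt.2 fun y => (hderiv y).continuousAt
  have hfac : ((m + 1 : ℝ) * d) * (m.factorial : ℝ) * d ^ m = 1 := by
    rw [Nat.factorial_succ] at hdm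
    push_cast at hdm
    linear_combination hdm
  have hmf : (0 : ℝ) < m.factorial := by exact_mod_cast m.factorial_pos
  have hsign : ∀ y, 0 < y → F' y = (m + 1) * d * Real.exp (-(d * y)) * (d * y) ^ m *
      (Real.exp ((1 - 1 / d) * (d * y)) - ((1 - Real.exp (-(d * y))) / (d * y)) ^ m) := by
    intro y hy
    have he : Real.exp (-y) = Real.exp (-(d * y)) * Real.exp ((1 - 1 / d) * (d * y)) := by
      rw [← Real.exp_add]
      congr 1
      field_simp
      ring
    have hdiv : y ^ m / (m.factorial : ℝ) = (m + 1) * d * (d * y) ^ m := by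
      rw [div_eq_iff hmf.ne', mul_pow]
      linear_combination (-(y ^ m)) * hfac
    have hmul : (d * y) ^ m * ((1 - Real.exp (-(d * y))) / (d * y)) ^ m =
        (1 - Real.exp (-(d * y))) ^ m := by
      rw [← mul_pow, mul_div_cancel₀ _ (by positivity)]
    simp only [hF']
    rw [mul_div_right_comm, hdiv, he]
    linear_combination ((m + 1) * d * Real.exp (-(d * y))) * hmul
  rcases hx.eq_or_lt with rfl | hx0
  · simp [regP]
  suffices h : 0 ≤ F x by simpa [hF] using h
  by_cases hA : ((1 - Real.exp (-(d * x))) / (d * x)) ^ m ≤ Real.exp ((1 - 1 / d) * (d * x))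
  · have hmono : MonotoneOn F (Set.Icc 0 x) := by
      refine monotoneOn_of_deriv_nonneg (convex_Icc 0 x) hcont.continuousOn
        (fun y _ => (hderiv y).differentiableAt.differentiableWithinAt) fun y hy => ?_
      rw [interior_Icc] at hy
      have hy0 : 0 < y := hy.1
      rw [(hderiv y).deriv, hsign y hy0]
      exact mul_nonneg (by positivity) (sub_nonneg.2 (one_sub_exp_neg_div_pow_le_exp_of_le m
        (by positivity) (by gcongr; exact hy.2.le) hA))
    have h0 : F 0 = 0 := by simp [hF, regP]
    rw [← h0]
    exact hmono (Set.left_mem_Icc.2 hx) (Set.right_mem_Icc.2 hx) hx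
  · have hanti : AntitoneOn F (Set.Ici x) := by
      refine antitoneOn_of_deriv_nonpos (convex_Ici x) hcont.continuousOn
        (fun y _ => (hderiv y).differentiableAt.differentiableWithinAt) fun y hy => ?_
      rw [interior_Ici] at hy
      have hxy : x < y := hy
      have hy0 : 0 < y := hx0.trans hxy
      rw [(hderiv y).deriv, hsign y hy0]
      refine mul_nonpos_of_nonneg_of_nonpos (by positivity) (sub_nonpos.2 ?_)
      by_contra! hlt
      exact hA (one_sub_exp_neg_div_pow_le_exp_of_le m (by positivity) (by gcongr) hlt.le)
    have hlim : Tendsto F atTop (nhds 0) := by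
      have hexp : Tendsto (fun y : ℝ => Real.exp (-(d * y))) atTop (nhds 0) :=
        Real.tendsto_exp_neg_atTop_nhds_zero.comp (tendsto_id.const_mul_atTop hd)
      have hP : Tendsto (regP ((m + 1 : ℕ) : ℝ)) atTop (nhds 1) :=
        tendsto_regP_atTop (by positivity)
      simpa [hF] using hP.sub ((hexp.const_sub 1).pow (m + 1))
    exact le_of_tendsto hlim ((eventually_ge_atTop x).mono fun y hy =>
      hanti Set.self_mem_Ici hy hy)

theorem regP_one (x : ℝ) : regP 1 x = 1 - Real.exp (-x) := by
  simp [regP]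

theorem stmt7 (n : ℕ) (hn : 1 ≤ n) (x : ℝ) (hx : 0 ≤ x) :
    (1 - Real.exp (-x / Real.Gamma ((n:ℝ) + 1) ^ ((1:ℝ)/n))) ^ n ≤ regP n x ∧
      (n = 1 → (1 - Real.exp (-x / Real.Gamma ((n:ℝ) + 1) ^ ((1:ℝ)/n))) ^ n = regP n x) := by
  constructor
  · obtain ⟨m, rfl⟩ := Nat.exists_eq_add_of_le' hn
    rw [Real.Gamma_nat_eq_factorial]
    have hf : (0 : ℝ) < ((m + 1).factorial : ℝ) := by exact_mod_cast (m + 1).factorial_pos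
    set α : ℝ := ((m + 1).factorial : ℝ) ^ ((1 : ℝ) / (m + 1 : ℕ)) with hα
    have hα0 : 0 < α := Real.rpow_pos_of_pos hf _
    have hpow : α ^ (m + 1) = ((m + 1).factorial : ℝ) := by
      rw [hα, one_div, Real.rpow_inv_natCast_pow hf.le m.succ_ne_zero]
    have h := one_sub_exp_pow_le_regP m (d := α⁻¹) (inv_pos.2 hα0)
      (by rw [inv_pow, hpow, inv_mul_cancel₀ hf.ne']) hx
    rwa [show -x / α = -(α⁻¹ * x) by ring]
  · rintro rfl
    have hG : Real.Gamma (1 + 1) = 1 := by simpa using Real.Gamma_nat_eq_factorial 1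
    simp [regP_one, hG]
end

section
/- Let N_E ≥ 1 be a natural number, γ̄_E > 0 and ε ∈ (0,1) real, and let z > 0 satisfy P(N_E, z) = 1 - ε. Let R_b > log₂(1 + γ̄_E · z) and set R_s = R_b - log₂(1 + γ̄_E · z). Then 0 < R_s < R_b, the secrecy outage probability satisfies p_so(R_b, R_s) = 1 - P(N_E, (2^{R_b - R_s} - 1)/γ̄_E) = ε, and for every R_s' with 0 < R_s' < R_b and p_so(R_b, R_s') ≤ ε one has R_s' ≤ R_s. -/
open Real MeasureTheory ProbabilityTheory Filter

theorem intervalIntegrable_rpow_mul_exp_neg {s : ℝ} (hs : 0 < s) (a b : ℝ) :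
    IntervalIntegrable (fun t : ℝ => t ^ (s - 1) * Real.exp (-t)) volume a b :=
  (intervalIntegral.intervalIntegrable_rpow' (by linarith)).mul_continuousOn
    (Real.continuous_exp.comp continuous_neg).continuousOn

theorem regP_strictMonoOn {s : ℝ} (hs : 0 < s) : StrictMonoOn (regP s) (Set.Ici 0) := by
  intro x hx y _ hxy
  have hpos : 0 < ∫ t in x..y, t ^ (s - 1) * Real.exp (-t) :=
    intervalIntegral.intervalIntegral_pos_of_pos_on
      (intervalIntegrable_rpow_mul_exp_neg hs x y)
      (fun t ht => mul_pos (Real.rpow_pos_of_pos (lt_of_le_of_lt hx ht.1) _)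
        (Real.exp_pos _)) hxy
  have hadd := intervalIntegral.integral_add_adjacent_intervals
    (intervalIntegrable_rpow_mul_exp_neg hs 0 x)
    (intervalIntegrable_rpow_mul_exp_neg hs x y)
  exact div_lt_div_of_pos_right (by linarith) (Real.Gamma_pos_of_pos hs)

theorem stmt12 (N_E : ℕ) (hE : 1 ≤ N_E) (γE ε z Rb Rs : ℝ) (hγ : 0 < γE)
    (hε : ε ∈ Set.Ioo (0:ℝ) 1) (hz : 0 < z) (hPz : regP N_E z = 1 - ε)
    (hRb : Real.logb 2 (1 + γE * z) < Rb)
    (hRs : Rs = Rb - Real.logb 2 (1 + γE * z)) :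
    0 < Rs ∧ Rs < Rb ∧ 1 - regP N_E ((2 ^ (Rb - Rs) - 1) / γE) = ε ∧
      ∀ Rs' : ℝ, 0 < Rs' → Rs' < Rb →
        1 - regP N_E ((2 ^ (Rb - Rs') - 1) / γE) ≤ ε → Rs' ≤ Rs := by
  have hγz : 0 < γE * z := mul_pos hγ hz
  have hlog : 0 < Real.logb 2 (1 + γE * z) :=
    Real.logb_pos (by norm_num) (by linarith)
  have hz_eq : ((2:ℝ) ^ (Rb - Rs) - 1) / γE = z := by
    rw [hRs, sub_sub_cancel, Real.rpow_logb (by norm_num) (by norm_num) (by linarith)]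
    field_simp
    ring
  refine ⟨by linarith, by linarith, by rw [hz_eq, hPz]; ring, fun Rs' _ hlt hout => ?_⟩
  by_contra! h
  have hone : (1:ℝ) < 2 ^ (Rb - Rs') :=
    Real.one_lt_rpow (by norm_num) (by linarith)
  have hpow : (2:ℝ) ^ (Rb - Rs') < 2 ^ (Rb - Rs) :=
    Real.rpow_lt_rpow_of_exponent_lt (by norm_num) (by linarith)
  have hy : 0 ≤ ((2:ℝ) ^ (Rb - Rs') - 1) / γE := div_nonneg (by linarith) hγ.le
  have hyz : ((2:ℝ) ^ (Rb - Rs') - 1) / γE < z := by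
    rw [← hz_eq]
    exact div_lt_div_of_pos_right (by linarith) hγ
  have := regP_strictMonoOn (s := N_E) (by exact_mod_cast hE) hy hz.le hyz
  linarith
end

section
/- Let N_A, N_B, N_E ≥ 1 be natural numbers, γ̄_B, γ̄_E > 0 and σ, ε ∈ (0,1) real, α = Γ(N_B + 1)^{1/N_B}, ρ = γ̄_B/γ̄_E, and let z > 0 satisfy P(N_E, z) = 1 - ε. If γ̄_E · z < γ̄_B · α · log(1 / (1 - (1-σ)^{1/(N_A · N_B)})), then σ < 1 - (1 - exp(-z / (ρ · α)))^{N_A · N_B}. -/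
open Real MeasureTheory ProbabilityTheory Filter

theorem stmt13 (N_A N_B N_E : ℕ) (hA : 1 ≤ N_A) (hB : 1 ≤ N_B) (hE : 1 ≤ N_E)
    (γB γE σ ε α ρ z : ℝ) (hγB : 0 < γB) (hγE : 0 < γE)
    (hσ : σ ∈ Set.Ioo (0:ℝ) 1) (hε : ε ∈ Set.Ioo (0:ℝ) 1)
    (hα : α = Real.Gamma ((N_B:ℝ) + 1) ^ ((1:ℝ)/N_B)) (hρ : ρ = γB / γE)
    (hz : 0 < z) (hPz : regP N_E z = 1 - ε)
    (h : γE * z < γB * α * Real.log (1 / (1 - (1 - σ) ^ ((1:ℝ)/(N_A * N_B))))) :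
    σ < 1 - (1 - Real.exp (-z / (ρ * α))) ^ (N_A * N_B) := by
  have hn : N_A * N_B ≠ 0 := by positivity
  have hα0 : 0 < α := hα ▸ Real.rpow_pos_of_pos (Real.Gamma_pos_of_pos (by positivity)) _
  have hρ0 : 0 < ρ := hρ ▸ div_pos hγB hγE
  have hσ0 : 0 < 1 - σ := sub_pos.mpr hσ.2
  set t := (1 - σ) ^ ((1:ℝ)/(N_A * N_B)) with ht
  have ht1 : t < 1 := Real.rpow_lt_one hσ0.le (by linarith [hσ.1]) (by positivity)
  have htn : t ^ (N_A * N_B) = 1 - σ := by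
    rw [ht, one_div, ← Nat.cast_mul, Real.rpow_inv_natCast_pow hσ0.le hn]
  have hlog : z / (ρ * α) < -Real.log (1 - t) := by
    rw [one_div, Real.log_inv] at h
    rw [div_lt_iff₀ (by positivity), hρ]
    field_simp
    linarith
  have hexp : 1 - t < Real.exp (-z / (ρ * α)) := by
    rw [← Real.log_lt_iff_lt_exp (by linarith), neg_div]
    linarith
  have hexp1 : Real.exp (-z / (ρ * α)) ≤ 1 := by
    rw [Real.exp_le_one_iff, neg_div]
    exact neg_nonpos.mpr (by positivity)
  have hpow : (1 - Real.exp (-z / (ρ * α))) ^ (N_A * N_B) < t ^ (N_A * N_B) :=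
    pow_lt_pow_left₀ (by linarith) (by linarith) hn
  linarith
end

section
/- Let N_A, N_B ≥ 1 be natural numbers, γ̄_B > 0 and R_e ≥ 0 real, and define T_s(R_b) = (R_b - R_e) · (1 - P(N_B, (2^{R_b} - 1)/γ̄_B)^{N_A}). Then T_s(R_b) tends to 0 as R_b → ∞. -/
open Real MeasureTheory ProbabilityTheory Filter

theorem integrableOn_rpow_mul_exp_neg {s : ℝ} (hs : 0 < s) :
    IntegrableOn (fun t : ℝ => t ^ (s - 1) * Real.exp (-t)) (Set.Ioi 0) := by
  simpa only [mul_comm] using Real.GammaIntegral_convergent hs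

theorem Gamma_eq_integral_rpow_mul_exp_neg {s : ℝ} (hs : 0 < s) :
    Real.Gamma s = ∫ t in Set.Ioi (0:ℝ), t ^ (s - 1) * Real.exp (-t) := by
  simpa only [mul_comm] using Real.Gamma_eq_integral hs

theorem regP_nonneg {s x : ℝ} (hs : 0 < s) (hx : 0 ≤ x) : 0 ≤ regP s x := by
  refine div_nonneg (intervalIntegral.integral_nonneg hx fun t ht => ?_)
    (Real.Gamma_pos_of_pos hs).le
  have := ht.1
  positivity

theorem one_sub_regP {s x : ℝ} (hs : 0 < s) (hx : 0 ≤ x) :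
    1 - regP s x =
      (∫ t in Set.Ioi x, t ^ (s - 1) * Real.exp (-t)) / Real.Gamma s := by
  have hG := Real.Gamma_pos_of_pos hs
  have hint := integrableOn_rpow_mul_exp_neg hs
  have hsplit := intervalIntegral.integral_interval_add_Ioi hint
    (hint.mono_set (Set.Ioi_subset_Ioi hx))
  rw [← Gamma_eq_integral_rpow_mul_exp_neg hs] at hsplit
  rw [regP, eq_div_iff hG.ne', sub_mul, div_mul_cancel₀ _ hG.ne']
  linarith

theorem regP_le_one {s x : ℝ} (hs : 0 < s) (hx : 0 ≤ x) : regP s x ≤ 1 := by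
  rw [← sub_nonneg, one_sub_regP hs hx]
  refine div_nonneg (setIntegral_nonneg measurableSet_Ioi fun t ht => ?_)
    (Real.Gamma_pos_of_pos hs).le
  have : 0 ≤ t := hx.trans (le_of_lt ht)
  positivity

/-- Markov's inequality for the Gamma distribution. -/
theorem one_sub_regP_le {s x : ℝ} (hs : 0 < s) (hx : 0 < x) : 1 - regP s x ≤ s / x := by
  have hG := Real.Gamma_pos_of_pos hs
  have hint := integrableOn_rpow_mul_exp_neg hs
  have hint' : IntegrableOn (fun t : ℝ => t ^ s * Real.exp (-t)) (Set.Ioi 0) := by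
    simpa using integrableOn_rpow_mul_exp_neg (add_pos hs one_pos)
  have hG' : ∫ t in Set.Ioi (0:ℝ), t ^ s * Real.exp (-t) = s * Real.Gamma s := by
    rw [← Real.Gamma_add_one hs.ne', Gamma_eq_integral_rpow_mul_exp_neg (add_pos hs one_pos)]
    simp
  have hsub : Set.Ioi x ⊆ Set.Ioi 0 := Set.Ioi_subset_Ioi hx.le
  have htail : x * ∫ t in Set.Ioi x, t ^ (s - 1) * Real.exp (-t) ≤ s * Real.Gamma s := by
    rw [← hG', ← integral_const_mul]
    refine le_trans (setIntegral_mono_on ((hint.mono_set hsub).const_mul x)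
      (hint'.mono_set hsub) measurableSet_Ioi fun t ht => ?_)
      (setIntegral_mono_set hint' ?_ hsub.eventuallyLE)
    · have ht0 : 0 < t := hsub ht
      have hxt : x ≤ t := le_of_lt ht
      have ht1 : t ^ s = t * t ^ (s - 1) := by
        rw [Real.rpow_sub_one ht0.ne', mul_div_cancel₀ _ ht0.ne']
      rw [ht1, mul_assoc]
      gcongr
    · filter_upwards [ae_restrict_mem measurableSet_Ioi] with t ht
      have : 0 < t := ht
      simp only [Pi.zero_apply]
      positivity
  rw [one_sub_regP hs hx.le, div_le_div_iff₀ hG hx]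
  linarith

theorem sq_mul_log_le_rpow_sub_one {a r : ℝ} (ha : 1 ≤ a) (hr : 0 ≤ r) :
    (Real.log a * r) ^ 2 / 2 ≤ a ^ r - 1 := by
  have h0 : 0 ≤ Real.log a * r := mul_nonneg (Real.log_nonneg ha) hr
  rw [Real.rpow_def_of_pos (one_pos.trans_le ha)]
  linarith [Real.quadratic_le_exp_of_nonneg h0]

theorem stmt17 (N_A N_B : ℕ) (hA : 1 ≤ N_A) (hB : 1 ≤ N_B) (γB Re : ℝ)
    (hγ : 0 < γB) (hRe : 0 ≤ Re) :
    Tendsto (fun Rb : ℝ => (Rb - Re) * (1 - regP N_B ((2 ^ Rb - 1) / γB) ^ N_A))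
      atTop (nhds 0) := by
  have hs : (0:ℝ) < N_B := by exact_mod_cast hB
  have hlog : 0 < Real.log 2 := Real.log_pos one_lt_two
  have hlim : Tendsto (fun r : ℝ => 2 * N_A * N_B * γB / Real.log 2 ^ 2 / r) atTop (nhds 0) :=
    tendsto_const_nhds.div_atTop tendsto_id
  refine tendsto_of_tendsto_of_tendsto_of_le_of_le' tendsto_const_nhds hlim ?_ ?_
  all_goals
    filter_upwards [eventually_gt_atTop 0, eventually_ge_atTop Re] with r hr hrRe
    have hquad := sq_mul_log_le_rpow_sub_one one_le_two hr.le
    have hq : 0 < (Real.log 2 * r) ^ 2 / 2 := by positivity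
    have hx : 0 < ((2:ℝ) ^ r - 1) / γB := div_pos (hq.trans_le hquad) hγ
    have hP0 := regP_nonneg hs hx.le
    have hP1 := regP_le_one hs hx.le
  · exact mul_nonneg (sub_nonneg.2 hrRe) (sub_nonneg.2 (pow_le_one₀ hP0 hP1))
  · have hbern := one_add_mul_sub_le_pow (n := N_A)
      (show -1 ≤ regP N_B ((2 ^ r - 1) / γB) by linarith)
    have hpow0 : 0 ≤ 1 - regP N_B ((2 ^ r - 1) / γB) ^ N_A :=
      sub_nonneg.2 (pow_le_one₀ hP0 hP1)
    calc (r - Re) * (1 - regP N_B ((2 ^ r - 1) / γB) ^ N_A)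
        ≤ r * (N_A * (1 - regP N_B ((2 ^ r - 1) / γB))) := by
          gcongr <;> linarith
      _ ≤ r * (N_A * (N_B / ((2 ^ r - 1) / γB))) := by
          gcongr
          exact one_sub_regP_le hs hx
      _ ≤ r * (N_A * (N_B / ((Real.log 2 * r) ^ 2 / 2 / γB))) := by
          gcongr
      _ = 2 * N_A * N_B * γB / Real.log 2 ^ 2 / r := by
          field_simp
end
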